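/- arXiv:2108.09414 — 2 statements merged into one kernel-verified Lean document; each statement's English description precedes it below -/
import Mathlib

section
/- For every integer n ≥ 1: if n is odd then m^e_{1,4}(n) = m^o_{3,4}(n), and if n is even then m^e_{1,4}(n) = m^o_{3,4}(n) + q^e(n/2). Here m^e_{1,4}(n) counts partitions of n with mex ≡ 1 (mod 4) and an even number of parts, m^o_{3,4}(n) counts partitions of n with mex ≡ 3 (mod 4) and an odd number of parts, and q^e(m) counts partitions of m into distinct parts with an even number of parts. -/
/-- The mex of a partition: the smallest positive integer that is not a part. -/
noncomputable def partMex {n : ℕ} (P : Nat.Partition n) : ℕ :=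
  sInf {k : ℕ | 0 < k ∧ k ∉ P.parts}

/-- `qEven m` is the number of partitions of `m` into distinct parts having an even number
of parts. -/
noncomputable def qEven (m : ℕ) : ℕ :=
  Nat.card {P : Nat.Partition m // P.parts.Nodup ∧ Even (Multiset.card P.parts)}

open PowerSeries Finset Filter
open scoped PowerSeries.WithPiTopology Topology

/-- Shanks' finite form of Gauss' identity for the triangular numbers. -/
theorem shanks_finite {R : Type*} [CommRing R] (q : R) (m : ℕ) :
    (∏ k ∈ range m, (1 - q ^ (2 * k + 1))) * ∑ j ∈ range (2 * m), q ^ (j * (j + 1) / 2) =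
      ∑ s ∈ range m, (∏ k ∈ range s, (1 - q ^ (2 * k + 1))) *
        (∏ k ∈ Ico s m, (1 - q ^ (2 * k + 2))) * q ^ (s * (2 * m + 1)) := by
  induction m with
  | zero => simp
  | succ m ih =>
    have telescope : ∑ s ∈ range m, ((∏ k ∈ range s, (1 - q ^ (2 * k + 1))) *
          (∏ k ∈ Ico s (m + 1), (1 - q ^ (2 * k + 2))) * q ^ (s * (2 * (m + 1) + 1)) -
        (1 - q ^ (2 * m + 1)) * ((∏ k ∈ range s, (1 - q ^ (2 * k + 1))) *
          (∏ k ∈ Ico s m, (1 - q ^ (2 * k + 2))) * q ^ (s * (2 * m + 1)))) =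
        (∏ k ∈ range m, (1 - q ^ (2 * k + 1))) * q ^ (m * (2 * m + 1)) * (1 - q ^ (2 * m)) := by
      let G : ℕ → R := fun s => (∏ k ∈ range s, (1 - q ^ (2 * k + 1))) *
        (∏ k ∈ Ico s m, (1 - q ^ (2 * k + 2))) * q ^ (s * (2 * m + 1)) * (1 - q ^ (2 * s))
      have hG : ∑ s ∈ range m, (G (s + 1) - G s) = G m - G 0 := sum_range_sub G m
      have hGm : G m = (∏ k ∈ range m, (1 - q ^ (2 * k + 1))) * q ^ (m * (2 * m + 1)) *
          (1 - q ^ (2 * m)) := by simp [G]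
      rw [show G 0 = 0 by simp [G], sub_zero, hGm] at hG
      rw [← hG]
      refine sum_congr rfl fun s hs => ?_
      have hs' : s < m := mem_range.mp hs
      simp only [G]
      rw [prod_Ico_succ_top hs'.le, prod_eq_prod_Ico_succ_bot hs' (fun k => 1 - q ^ (2 * k + 2)),
        prod_range_succ]
      ring
    rw [sum_sub_distrib, ← mul_sum, ← ih] at telescope
    have h1 : 2 * m * (2 * m + 1) / 2 = m * (2 * m + 1) := by
      rw [mul_assoc, Nat.mul_div_cancel_left _ two_pos]
    have h2 : (2 * m + 1) * (2 * m + 1 + 1) / 2 = m * (2 * m + 1) + (2 * m + 1) := by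
      rw [show (2 * m + 1) * (2 * m + 1 + 1) = 2 * (m * (2 * m + 1) + (2 * m + 1)) by ring,
        Nat.mul_div_cancel_left _ two_pos]
    rw [sum_range_succ, show 2 * (m + 1) = 2 * m + 1 + 1 by ring, sum_range_succ _ (2 * m + 1),
      sum_range_succ _ (2 * m), prod_range_succ, h1, h2, Nat.Ico_succ_singleton, prod_singleton]
    rw [show 2 * (m + 1) = 2 * m + 1 + 1 by ring] at telescope
    linear_combination -telescope

theorem multipliable_one_add_C_mul_X_pow (c : ℕ → ℤ) {a : ℕ → ℕ} (ha : ∀ i, i < a i) :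
    Multipliable fun i => (1 : ℤ⟦X⟧) + C (c i) * X ^ a i := by
  apply PowerSeries.WithPiTopology.multipliable_one_add_of_tendsto_order_atTop_nhds_top
  refine ENat.tendsto_nhds_top_iff_natCast_lt.mpr fun n => eventually_atTop.mpr ⟨n, fun m hm => ?_⟩
  grw [← le_order_mul, order_X_pow]
  refine lt_add_of_nonneg_of_lt (by simp) ?_
  have := ha m
  norm_cast
  omega

/-- The product `∏ (1 + z X ^ i)` over all `i ≥ 1`. -/
noncomputable def distinctProd (z : ℤ) : ℤ⟦X⟧ := ∏' i : ℕ, (1 + C z * X ^ (i + 1))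

/-- The product `∏ (1 + z X ^ i)` over the odd `i ≥ 1`. -/
noncomputable def oddProd (z : ℤ) : ℤ⟦X⟧ := ∏' i : ℕ, (1 + C z * X ^ (2 * i + 1))

/-- The product `∏ (1 + z X ^ i)` over the even `i ≥ 1`. -/
noncomputable def evenProd (z : ℤ) : ℤ⟦X⟧ := ∏' i : ℕ, (1 + C z * X ^ (2 * i + 2))

/-- The generating function of the triangular numbers. -/
noncomputable def triangularSeries : ℤ⟦X⟧ := ∑' j : ℕ, X ^ (j * (j + 1) / 2)

theorem hasProd_distinctProd (z : ℤ) :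
    HasProd (fun i : ℕ => (1 : ℤ⟦X⟧) + C z * X ^ (i + 1)) (distinctProd z) :=
  (multipliable_one_add_C_mul_X_pow (fun _ => z) fun i => by omega).hasProd

theorem hasProd_oddProd (z : ℤ) :
    HasProd (fun i : ℕ => (1 : ℤ⟦X⟧) + C z * X ^ (2 * i + 1)) (oddProd z) :=
  (multipliable_one_add_C_mul_X_pow (fun _ => z) fun i => by omega).hasProd

theorem hasProd_evenProd (z : ℤ) :
    HasProd (fun i : ℕ => (1 : ℤ⟦X⟧) + C z * X ^ (2 * i + 2)) (evenProd z) :=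
  (multipliable_one_add_C_mul_X_pow (fun _ => z) fun i => by omega).hasProd

theorem distinctProd_eq (z : ℤ) : distinctProd z = oddProd z * evenProd z :=
  (hasProd_distinctProd z).unique ((hasProd_oddProd z).even_mul_odd (hasProd_evenProd z))

theorem distinctProd_neg_mul : distinctProd (-1) * distinctProd 1 = evenProd (-1) := by
  refine ((hasProd_distinctProd (-1)).mul (hasProd_distinctProd 1)).unique ?_
  convert hasProd_evenProd (-1) using 2
  simp only [map_neg, map_one]
  ring

theorem le_triangular (j : ℕ) : j ≤ j * (j + 1) / 2 := by
  rcases Nat.eq_zero_or_pos j with rfl | h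
  · simp
  · rw [Nat.le_div_iff_mul_le two_pos]; nlinarith

theorem hasSum_triangularSeries :
    HasSum (fun j : ℕ => (X : ℤ⟦X⟧) ^ (j * (j + 1) / 2)) triangularSeries := by
  refine Summable.hasSum ?_
  apply PowerSeries.WithPiTopology.summable_of_tendsto_order_atTop_nhds_top
  refine ENat.tendsto_nhds_top_iff_natCast_lt.mpr fun n => eventually_atTop.mpr
    ⟨n + 1, fun m hm => ?_⟩
  have := le_triangular m
  rw [order_X_pow]
  norm_cast
  omega

theorem constantCoeff_evenProd (z : ℤ) : constantCoeff (evenProd z) = 1 := by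
  have := (hasProd_evenProd z).map (constantCoeff (R := ℤ))
    (WithPiTopology.continuous_constantCoeff ℤ)
  refine this.unique ?_
  convert hasProd_one using 1
  ext i; simp

theorem evenProd_ne_zero (z : ℤ) : evenProd z ≠ 0 := fun h => by
  simpa [h] using constantCoeff_evenProd z

theorem oddProd_mul_distinctProd : oddProd (-1) * distinctProd 1 = 1 := by
  apply mul_right_cancel₀ (evenProd_ne_zero (-1))
  have := distinctProd_neg_mul
  rw [distinctProd_eq (-1)] at this
  linear_combination this

/-- **Gauss' identity**: `∑ X ^ (j (j + 1) / 2) = ∏ (1 - X ^ (2 i)) / (1 - X ^ (2 i - 1))`. -/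
theorem triangularSeries_mul_oddProd : triangularSeries * oddProd (-1) = evenProd (-1) := by
  have hO := (hasProd_oddProd (-1)).tendsto_prod_nat
  have hE := (hasProd_evenProd (-1)).tendsto_prod_nat
  have hT := hasSum_triangularSeries.tendsto_sum_nat.comp
    (tendsto_id.const_mul_atTop' (two_pos : (0 : ℕ) < 2))
  have h := hO.mul hT
  rw [mul_comm]
  refine tendsto_nhds_unique h ?_
  rw [WithPiTopology.tendsto_iff_coeff_tendsto] at hE ⊢
  intro d
  refine (hE d).congr' (eventually_atTop.mpr ⟨d + 1, fun m hm => ?_⟩)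
  have key := shanks_finite (X : ℤ⟦X⟧) m
  simp only [map_neg, map_one, neg_one_mul, ← sub_eq_add_neg, Function.comp, id] at key ⊢
  rw [key]
  obtain ⟨m, rfl⟩ : ∃ k, m = k + 1 := ⟨m - 1, by omega⟩
  rw [sum_range_succ', map_add, map_sum, sum_eq_zero, zero_add]
  · rw [prod_range_zero, one_mul, zero_mul, pow_zero, mul_one, range_eq_Ico]
  · intro s hs
    rw [coeff_mul_X_pow', if_neg]
    have : 2 * (m + 1) + 1 ≤ (s + 1) * (2 * (m + 1) + 1) := Nat.le_mul_of_pos_left _ s.succ_pos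
    omega

theorem continuous_rescale (a : ℤ) : Continuous (rescale a : ℤ⟦X⟧ →+* ℤ⟦X⟧) := by
  rw [continuous_iff_continuousAt]
  intro f
  rw [ContinuousAt, WithPiTopology.tendsto_iff_coeff_tendsto]
  intro d
  simp only [coeff_rescale]
  exact (WithPiTopology.continuous_coeff ℤ d).continuousAt.const_mul _

theorem continuous_expand {p : ℕ} (hp : p ≠ 0) : Continuous (expand p hp : ℤ⟦X⟧ →ₐ[ℤ] ℤ⟦X⟧) := by
  rw [continuous_iff_continuousAt]
  intro f
  rw [ContinuousAt, WithPiTopology.tendsto_iff_coeff_tendsto]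
  intro d
  simp only [coeff_expand]
  split_ifs
  · exact (WithPiTopology.continuous_coeff ℤ _).continuousAt
  · exact tendsto_const_nhds

theorem expand_distinctProd (z : ℤ) : expand 2 two_ne_zero (distinctProd z) = evenProd z := by
  refine ((hasProd_distinctProd z).map _ (continuous_expand two_ne_zero)).unique ?_
  convert hasProd_evenProd z using 2
  simp [expand_X, ← pow_mul, mul_add]

theorem rescale_oddProd : rescale (-1) (oddProd (-1)) = oddProd 1 := by
  refine ((hasProd_oddProd (-1)).map _ (continuous_rescale (-1))).unique ?_
  convert hasProd_oddProd 1 using 2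
  simp [rescale_X, pow_succ, pow_mul]

theorem rescale_evenProd : rescale (-1) (evenProd (-1)) = evenProd (-1) := by
  refine ((hasProd_evenProd (-1)).map _ (continuous_rescale (-1))).unique ?_
  convert hasProd_evenProd (-1) using 2
  simp [rescale_X, pow_succ, pow_mul]

theorem triangularSeries_eq :
    triangularSeries = expand 2 two_ne_zero (distinctProd (-1)) * distinctProd 1 := by
  rw [expand_distinctProd, ← triangularSeries_mul_oddProd, mul_assoc, oddProd_mul_distinctProd,
    mul_one]

theorem rescale_triangularSeries_eq : rescale (-1) triangularSeries =
    expand 2 two_ne_zero (distinctProd 1) * distinctProd (-1) := by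
  have h := congrArg (rescale (-1)) triangularSeries_mul_oddProd
  rw [map_mul, rescale_oddProd, rescale_evenProd] at h
  have h1 := oddProd_mul_distinctProd
  rw [expand_distinctProd]
  rw [distinctProd_eq] at h1 ⊢
  linear_combination (oddProd (-1) * evenProd 1) * h - rescale (-1) triangularSeries * h1

/-- The generating function of partitions weighted by `z ^ (number of parts)`. -/
noncomputable def partitionSeries (z : ℤ) : ℤ⟦X⟧ :=
  PowerSeries.mk fun n => ∑ P : n.Partition, z ^ Multiset.card P.parts

theorem partitionSeries_mul_distinctProd (z : ℤ) :
    partitionSeries z * distinctProd (-z) = 1 := by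
  have h := Nat.Partition.hasProd_genFun (fun _ c => z ^ c)
  have hg : Nat.Partition.genFun (fun _ c => z ^ c) = partitionSeries z := by
    ext n
    simp only [Nat.Partition.coeff_genFun, partitionSeries, coeff_mk, Finsupp.prod,
      prod_pow_eq_pow_sum]
    simp
  rw [hg] at h
  refine (h.mul (hasProd_distinctProd (-z))).unique ?_
  convert hasProd_one using 1
  ext1 i
  have hc : constantCoeff (C z * X ^ (i + 1) : ℤ⟦X⟧) = 0 := by simp
  have hs := WithPiTopology.summable_pow_of_constantCoeff_eq_zero hc
  have := WithPiTopology.tsum_pow_mul_one_sub_of_constantCoeff_eq_zero hc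
  rw [hs.tsum_eq_zero_add] at this
  refine Eq.trans ?_ this
  congr 1
  · rw [pow_zero]
    congr 2
    ext1 j
    rw [mul_pow, ← map_pow, ← pow_mul, smul_eq_C_mul]
  · rw [map_neg, neg_mul, sub_eq_add_neg]

theorem coeff_distinctProd (z : ℤ) (n : ℕ) : coeff n (distinctProd z) =
    ∑ P : n.Partition with P.parts.Nodup, z ^ Multiset.card P.parts := by
  have h := Nat.Partition.hasProd_genFun (fun _ c => if c = 1 then z else 0)
  have hd : distinctProd z = Nat.Partition.genFun (fun _ c => if c = 1 then z else 0) := by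
    refine (hasProd_distinctProd z).unique ?_
    refine (congrArg (HasProd · _) (funext fun i => ?_)).mp h
    rw [tsum_eq_single 0 (fun j hj => by rw [if_neg (by omega)]; exact zero_smul ℤ _)]
    simp [smul_eq_C_mul]
  rw [hd, Nat.Partition.coeff_genFun, sum_filter]
  refine sum_congr rfl fun P _ => ?_
  rw [Finsupp.prod]
  split_ifs with hP
  · rw [prod_congr rfl (g := fun _ => z)]
    · rw [prod_const, Multiset.toFinsupp_support, Multiset.toFinset_card_of_nodup hP]
    · intro i hi
      rw [Multiset.toFinsupp_support, Multiset.mem_toFinset] at hi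
      simp [Multiset.count_eq_one_of_mem hP hi]
  · rw [Multiset.nodup_iff_count_le_one] at hP
    push Not at hP
    obtain ⟨i, hi⟩ := hP
    refine prod_eq_zero (i := i) ?_ ?_
    · rw [Multiset.toFinsupp_support, Multiset.mem_toFinset, ← Multiset.count_pos]
      omega
    · rw [Multiset.toFinsupp_apply, if_neg (by omega)]

theorem lt_partMex_iff {n : ℕ} (P : n.Partition) (k : ℕ) :
    k < partMex P ↔ (Icc 1 k).val ≤ P.parts := by
  have hne : {k : ℕ | 0 < k ∧ k ∉ P.parts}.Nonempty :=
    ⟨n + 1, n.succ_pos, fun h => by have := Nat.Partition.le_of_mem_parts h; omega⟩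
  rw [Multiset.le_iff_subset (Icc 1 k).nodup, partMex]
  constructor
  · intro h i hi
    by_contra hmem
    have hi' := mem_Icc.mp (mem_val.mp hi)
    exact absurd (Nat.sInf_le (show i ∈ {k : ℕ | 0 < k ∧ k ∉ P.parts} from ⟨by omega, hmem⟩))
      (by omega)
  · intro h
    by_contra hlt
    obtain ⟨h1, h2⟩ := Nat.sInf_mem hne
    exact h2 (h (mem_val.mpr (mem_Icc.mpr ⟨h1, not_lt.mp hlt⟩)))

theorem partMex_le {n : ℕ} (P : n.Partition) : partMex P ≤ n + 1 :=
  Nat.sInf_le ⟨n.succ_pos, fun h => by have := Nat.Partition.le_of_mem_parts h; omega⟩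

theorem sum_Icc_val (k : ℕ) : (Icc 1 k).val.sum = k * (k + 1) / 2 := by
  induction k with
  | zero => simp
  | succ k ih =>
    rw [← insert_Icc_right_eq_Icc_add_one (by omega), insert_val_of_notMem (by simp),
      Multiset.sum_cons, ih]
    have : (k + 1) * (k + 1 + 1) = k * (k + 1) + (k + 1) * 2 := by ring
    omega

theorem sum_lt_partMex (z : ℤ) (n k : ℕ) :
    ∑ P : n.Partition with k < partMex P, z ^ Multiset.card P.parts =
      z ^ k * coeff n (X ^ (k * (k + 1) / 2) * partitionSeries z) := by
  rw [coeff_X_pow_mul']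
  simp only [lt_partMex_iff]
  split_ifs with h
  · rw [partitionSeries, coeff_mk, mul_sum]
    refine sum_bij' (fun P hP => ⟨P.parts - (Icc 1 k).val, fun hi => P.parts_pos
        (Multiset.mem_of_le (Multiset.sub_le_self _ _) hi), ?_⟩)
      (fun Q _ => ⟨Q.parts + (Icc 1 k).val, fun hi => ?_, ?_⟩) ?_ ?_ ?_ ?_ ?_
    · have := congrArg Multiset.sum (Multiset.sub_add_cancel (mem_filter.mp hP).2)
      rw [Multiset.sum_add, sum_Icc_val, P.parts_sum] at this
      omega
    · rcases Multiset.mem_add.mp hi with hi | hi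
      · exact Q.parts_pos hi
      · exact (mem_Icc.mp (mem_val.mp hi)).1
    · rw [Multiset.sum_add, sum_Icc_val, Q.parts_sum]
      omega
    · simp
    · simp
    · intro P hP
      exact Nat.Partition.ext (Multiset.sub_add_cancel (mem_filter.mp hP).2)
    · intro Q _
      exact Nat.Partition.ext (Multiset.add_sub_cancel_right)
    · intro P hP
      have := congrArg Multiset.card (Multiset.sub_add_cancel (mem_filter.mp hP).2)
      rw [Multiset.card_add, card_val, Nat.card_Icc, Nat.add_sub_cancel] at this
      rw [← this, pow_add, mul_comm]
  · rw [mul_zero]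
    refine sum_eq_zero fun P hP => absurd ?_ h
    rw [← sum_Icc_val, ← P.parts_sum]
    obtain ⟨u, hu⟩ := Multiset.le_iff_exists_add.mp (mem_filter.mp hP).2
    rw [hu, Multiset.sum_add]
    exact Nat.le_add_right _ _

theorem sum_range_mul_sum_lt_partMex (z : ℤ) (w : ℕ → ℤ) (n : ℕ) :
    ∑ k ∈ range (n + 1), w k * ∑ P : n.Partition with k < partMex P, z ^ Multiset.card P.parts =
      ∑ P : n.Partition, z ^ Multiset.card P.parts * ∑ k ∈ range (partMex P), w k := by
  simp only [sum_filter, mul_sum]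
  rw [sum_comm]
  refine sum_congr rfl fun P _ => ?_
  have hf : range (partMex P) = {k ∈ range (n + 1) | k < partMex P} := by
    ext k
    have := partMex_le P
    simp only [mem_filter, mem_range]
    omega
  rw [hf, sum_filter]
  exact sum_congr rfl fun k _ => by split_ifs <;> ring

theorem coeff_rescale_triangularSeries_mul (a : ℤ) (f : ℤ⟦X⟧) (n : ℕ) :
    coeff n (rescale a triangularSeries * f) = ∑ k ∈ range (n + 1),
      a ^ (k * (k + 1) / 2) * coeff n (X ^ (k * (k + 1) / 2) * f) := by
  have h := ((hasSum_triangularSeries.map _ (continuous_rescale a)).mul_right f).map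
    (coeff (R := ℤ) n) (WithPiTopology.continuous_coeff ℤ n)
  have hterm (k : ℕ) : coeff n (rescale a ((X : ℤ⟦X⟧) ^ (k * (k + 1) / 2)) * f) =
      a ^ (k * (k + 1) / 2) * coeff n (X ^ (k * (k + 1) / 2) * f) := by
    rw [map_pow, rescale_X, mul_pow, ← map_pow, mul_assoc, coeff_C_mul]
  refine h.unique ?_
  simp only [Function.comp_def, hterm]
  refine hasSum_sum_of_ne_finset_zero fun k hk => ?_
  have := le_triangular k
  rw [mem_range] at hk
  rw [coeff_X_pow_mul', if_neg (by omega), mul_zero]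

theorem sum_range_neg_one_pow_triangular (m : ℕ) :
    ∑ k ∈ range m, (-1 : ℤ) ^ (k * (k + 1) / 2) =
      if m % 4 = 1 then 1 else if m % 4 = 3 then -1 else 0 := by
  induction m with
  | zero => simp
  | succ m ih =>
    rw [sum_range_succ, ih]
    obtain ⟨t, ht⟩ := Nat.even_mul_succ_self m
    rw [ht, ← two_mul, Nat.mul_div_cancel_left _ two_pos]
    obtain ⟨q, r, hr, rfl⟩ : ∃ q r, r < 4 ∧ m = 4 * q + r :=
      ⟨m / 4, m % 4, Nat.mod_lt _ (by norm_num), (Nat.div_add_mod m 4).symm⟩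
    interval_cases r
    · have : Even t := ⟨4 * q ^ 2 + q, by linarith⟩
      rw [this.neg_one_pow, if_neg (by omega), if_neg (by omega), if_pos (by omega), zero_add]
    · have : Odd t := ⟨4 * q ^ 2 + 3 * q, by linarith⟩
      rw [this.neg_one_pow, if_pos (by omega), if_neg (by omega), if_neg (by omega),
        add_neg_cancel]
    · have : Odd t := ⟨4 * q ^ 2 + 5 * q + 1, by linarith⟩
      rw [this.neg_one_pow, if_neg (by omega), if_neg (by omega), if_neg (by omega),
        if_pos (by omega), zero_add]
    · have : Even t := ⟨4 * q ^ 2 + 7 * q + 3, by linarith⟩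
      rw [this.neg_one_pow, if_neg (by omega), if_pos (by omega), if_neg (by omega),
        if_neg (by omega), neg_add_cancel]

theorem sum_range_neg_one_pow (m : ℕ) :
    ∑ k ∈ range m, (-1 : ℤ) ^ k = if m % 2 = 1 then 1 else 0 := by
  induction m with
  | zero => simp
  | succ m ih =>
    rw [sum_range_succ, ih]
    rcases Nat.even_or_odd m with h | h
    · have := Nat.even_iff.mp h
      rw [h.neg_one_pow, if_neg (by omega), if_pos (by omega), zero_add]
    · have := Nat.odd_iff.mp h
      rw [h.neg_one_pow, if_pos (by omega), if_neg (by omega), add_neg_cancel]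

theorem sum_partMex_one (n : ℕ) :
    ∑ P : n.Partition, (if partMex P % 4 = 1 then (1 : ℤ) else if partMex P % 4 = 3 then -1 else 0)
      = coeff n (expand 2 two_ne_zero (distinctProd 1)) := by
  have h1 : rescale (-1) triangularSeries * partitionSeries 1 =
      expand 2 two_ne_zero (distinctProd 1) := by
    rw [rescale_triangularSeries_eq, mul_assoc, mul_comm (distinctProd (-1)),
      partitionSeries_mul_distinctProd, mul_one]
  rw [← h1, coeff_rescale_triangularSeries_mul]
  have h2 := sum_range_mul_sum_lt_partMex 1 (fun k => (-1) ^ (k * (k + 1) / 2)) n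
  simp only [sum_lt_partMex, sum_range_neg_one_pow_triangular] at h2
  simpa using h2.symm

theorem sum_partMex_neg_one (n : ℕ) :
    ∑ P : n.Partition, (-1 : ℤ) ^ Multiset.card P.parts * (if partMex P % 2 = 1 then 1 else 0)
      = coeff n (expand 2 two_ne_zero (distinctProd (-1))) := by
  have h1 : rescale 1 triangularSeries * partitionSeries (-1) =
      expand 2 two_ne_zero (distinctProd (-1)) := by
    have := partitionSeries_mul_distinctProd (-1)
    rw [neg_neg] at this
    rw [rescale_one, RingHom.id_apply, triangularSeries_eq, mul_assoc, mul_comm (distinctProd 1),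
      this, mul_one]
  rw [← h1, coeff_rescale_triangularSeries_mul]
  have h2 := sum_range_mul_sum_lt_partMex (-1) (fun k => (-1) ^ k) n
  simp only [sum_lt_partMex, sum_range_neg_one_pow, ← mul_assoc, ← mul_pow] at h2
  simpa using h2.symm

theorem two_mul_card_sub_card (n : ℕ) :
    2 * ((Nat.card {P : n.Partition // partMex P % 4 = 1 ∧ Even (Multiset.card P.parts)} : ℤ) -
      Nat.card {P : n.Partition // partMex P % 4 = 3 ∧ Odd (Multiset.card P.parts)}) =
    coeff n (expand 2 two_ne_zero (distinctProd 1)) +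
      coeff n (expand 2 two_ne_zero (distinctProd (-1))) := by
  classical
  rw [← sum_partMex_one, ← sum_partMex_neg_one, ← sum_add_distrib, Nat.card_eq_fintype_card,
    Nat.card_eq_fintype_card, Fintype.card_subtype, Fintype.card_subtype, card_filter, card_filter]
  push_cast
  rw [← sum_sub_distrib, mul_sum]
  refine sum_congr rfl fun P _ => ?_
  rcases Nat.even_or_odd (Multiset.card P.parts) with h | h
  · have h' := Nat.not_odd_iff_even.mpr h
    simp only [h, h', h.neg_one_pow, and_true, and_false, reduceIte]
    split_ifs <;> omega
  · have h' := Nat.not_even_iff_odd.mpr h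
    simp only [h, h', h.neg_one_pow, and_true, and_false, reduceIte]
    split_ifs <;> omega

theorem two_mul_qEven (m : ℕ) :
    2 * (qEven m : ℤ) = coeff m (distinctProd 1) + coeff m (distinctProd (-1)) := by
  classical
  rw [coeff_distinctProd, coeff_distinctProd, ← sum_add_distrib, qEven, Nat.card_eq_fintype_card,
    Fintype.card_subtype, ← filter_filter, card_filter]
  push_cast
  rw [mul_sum]
  refine sum_congr rfl fun P _ => ?_
  rcases Nat.even_or_odd (Multiset.card P.parts) with h | h
  · simp [h, h.neg_one_pow]
  · simp [Nat.not_even_iff_odd.mpr h, h.neg_one_pow]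

/-- For `n ≥ 1`: if `n` is odd then `m^e_{1,4}(n) = m^o_{3,4}(n)`, and if `n` is even then
`m^e_{1,4}(n) = m^o_{3,4}(n) + q^e(n/2)`. -/
theorem stmt_12 (n : ℕ) (hn : 1 ≤ n) :
    (Odd n →
      Nat.card {P : Nat.Partition n // partMex P % 4 = 1 ∧ Even (Multiset.card P.parts)} =
        Nat.card {P : Nat.Partition n // partMex P % 4 = 3 ∧ Odd (Multiset.card P.parts)}) ∧
    (Even n →
      Nat.card {P : Nat.Partition n // partMex P % 4 = 1 ∧ Even (Multiset.card P.parts)} =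
        Nat.card {P : Nat.Partition n // partMex P % 4 = 3 ∧ Odd (Multiset.card P.parts)} +
          qEven (n / 2)) := by
  have key := two_mul_card_sub_card n
  simp only [coeff_expand] at key
  refine ⟨fun h => ?_, fun h => ?_⟩
  · rw [if_neg h.not_two_dvd_nat, if_neg h.not_two_dvd_nat] at key
    omega
  · rw [if_pos h.two_dvd, if_pos h.two_dvd, ← two_mul_qEven] at key
    omega
end

section
/- For every integer n ≥ 2, let M^e_{≤0}(n) (resp. M^o_{≤0}(n)) be the number of partitions of n with crank at most 0 having an even (resp. odd) number of parts. If n is odd then M^e_{≤0}(n) = M^o_{≤0}(n), and if n is even then M^e_{≤0}(n) = M^o_{≤0}(n) + q(n/2), where q(m) is the number of partitions of m into distinct parts. -/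
/-- Number of parts equal to 1 in a partition. -/
def partOmega {n : ℕ} (P : Nat.Partition n) : ℕ := P.parts.count 1

/-- Number of parts strictly greater than `partOmega P`. -/
def partMu {n : ℕ} (P : Nat.Partition n) : ℕ :=
  (P.parts.filter (fun x => partOmega P < x)).card

/-- The crank of a partition: the largest part if there are no parts equal to 1,
and `μ(λ) - ω(λ)` otherwise. -/
def crank {n : ℕ} (P : Nat.Partition n) : ℤ :=
  if partOmega P = 0 then (P.parts.sup : ℤ)
  else (partMu P : ℤ) - (partOmega P : ℤ)

/-- `q m` is the number of partitions of `m` into distinct parts. -/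
noncomputable def q (m : ℕ) : ℕ := Nat.card {P : Nat.Partition m // P.parts.Nodup}

namespace CrankParity
open PowerSeries Multiset

/-- Multisets of `D` natural numbers with sum `N`. -/
def sumSet (D N : ℕ) : Finset (Multiset ℕ) :=
  (Finset.Iic (D • range (N + 1))).filter fun A => card A = D ∧ A.sum = N

/-- Multisets with elements in `[1, D]` and sum `N`. -/
def boundedSet (D N : ℕ) : Finset (Multiset ℕ) :=
  (Finset.Iic (N • range (N + 1))).filter fun B => (∀ x ∈ B, 1 ≤ x ∧ x ≤ D) ∧ B.sum = N

/-- Sets of `D` positive natural numbers with sum `N`. -/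
def distinctSet (D N : ℕ) : Finset (Multiset ℕ) :=
  (sumSet D N).filter fun A => A.Nodup ∧ 0 ∉ A

theorem le_nsmul_range {A : Multiset ℕ} {D N : ℕ} (hD : card A ≤ D) (hN : A.sum = N) :
    A ≤ D • range (N + 1) := by
  rw [le_iff_count]
  intro a
  by_cases ha : a ∈ A
  · have h1 : a ≤ N := hN ▸ single_le_sum (fun x _ => Nat.zero_le x) a ha
    rw [count_nsmul, count_eq_one_of_mem (nodup_range _) (by simp; omega)]
    have := count_le_card a A
    simp; omega
  · simp [count_eq_zero_of_notMem ha]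

theorem card_le_sum {A : Multiset ℕ} (h : ∀ x ∈ A, 1 ≤ x) : card A ≤ A.sum := by
  simpa using card_nsmul_le_sum (a := 1) h

theorem mem_sumSet {D N : ℕ} {A : Multiset ℕ} :
    A ∈ sumSet D N ↔ card A = D ∧ A.sum = N := by
  simp only [sumSet, Finset.mem_filter, Finset.mem_Iic, and_iff_right_iff_imp]
  exact fun h => le_nsmul_range h.1.le h.2

theorem mem_boundedSet {D N : ℕ} {B : Multiset ℕ} :
    B ∈ boundedSet D N ↔ (∀ x ∈ B, 1 ≤ x ∧ x ≤ D) ∧ B.sum = N := by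
  simp only [boundedSet, Finset.mem_filter, Finset.mem_Iic, and_iff_right_iff_imp]
  exact fun h => le_nsmul_range (h.2 ▸ card_le_sum fun x hx => (h.1 x hx).1) h.2

theorem mem_distinctSet {D N : ℕ} {A : Multiset ℕ} :
    A ∈ distinctSet D N ↔ (card A = D ∧ A.sum = N) ∧ A.Nodup ∧ 0 ∉ A := by
  rw [distinctSet, Finset.mem_filter, mem_sumSet]

theorem map_succ_map_pred {A : Multiset ℕ} (h : 0 ∉ A) : (A.map (· - 1)).map (· + 1) = A := by
  rw [map_map]
  conv_rhs => rw [← map_id A]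
  refine map_congr rfl fun x hx => ?_
  have : x ≠ 0 := fun h0 => h (h0 ▸ hx)
  simp; omega

theorem sum_map_succ (A : Multiset ℕ) : (A.map (· + 1)).sum = A.sum + card A := by
  simp [sum_map_add]

theorem card_sumSet_succ (D N : ℕ) : (sumSet (D + 1) N).card =
    (sumSet D N).card + if D + 1 ≤ N then (sumSet (D + 1) (N - (D + 1))).card else 0 := by
  rw [← Finset.card_filter_add_card_filter_not (fun A => 0 ∈ A)]
  congr 1
  · refine Finset.card_nbij' (fun A => A.erase 0) (fun A => 0 ::ₘ A) ?_ ?_ ?_ ?_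
    · intro A hA
      simp only [Finset.coe_filter, Set.mem_ofPred_eq, mem_sumSet, Finset.mem_coe] at hA ⊢
      obtain ⟨B, rfl⟩ := exists_cons_of_mem hA.2
      simpa using hA.1
    · intro A hA
      simp only [Finset.coe_filter, Set.mem_ofPred_eq, mem_sumSet, Finset.mem_coe] at hA ⊢
      simpa using hA
    · intro A hA
      simp only [Finset.coe_filter, Set.mem_ofPred_eq] at hA
      exact cons_erase hA.2
    · intro A _
      simp
  · split_ifs with h
    · refine Finset.card_nbij' (fun A => A.map (· - 1)) (fun A => A.map (· + 1)) ?_ ?_ ?_ ?_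
      · intro A hA
        simp only [Finset.coe_filter, Set.mem_ofPred_eq, mem_sumSet, Finset.mem_coe] at hA ⊢
        have := sum_map_succ (A.map (· - 1))
        rw [map_succ_map_pred hA.2, card_map] at this
        rw [card_map]
        omega
      · intro A hA
        simp only [Finset.coe_filter, Set.mem_ofPred_eq, mem_sumSet, Finset.mem_coe] at hA ⊢
        rw [sum_map_succ, card_map]
        refine ⟨by omega, by simp⟩
      · intro A hA
        simp only [Finset.coe_filter, Set.mem_ofPred_eq] at hA
        exact map_succ_map_pred hA.2
      · intro A _
        simp
    · rw [Finset.card_eq_zero, Finset.filter_eq_empty_iff]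
      intro A hA h0
      rw [mem_sumSet] at hA
      have := sum_map_succ (A.map (· - 1))
      rw [map_succ_map_pred h0, card_map] at this
      omega

theorem sum_boundedSet_succ (D N : ℕ) : ∑ B ∈ boundedSet (D + 1) N, (-1 : ℤ) ^ card B =
    ∑ B ∈ boundedSet D N, (-1 : ℤ) ^ card B -
      if D + 1 ≤ N then ∑ B ∈ boundedSet (D + 1) (N - (D + 1)), (-1 : ℤ) ^ card B else 0 := by
  rw [← Finset.sum_filter_add_sum_filter_not _ (fun B => D + 1 ∉ B), sub_eq_add_neg]
  congr 1
  · refine Finset.sum_congr ?_ fun _ _ => rfl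
    ext B
    simp only [Finset.mem_filter, mem_boundedSet]
    constructor
    · rintro ⟨⟨h1, h2⟩, h3⟩
      refine ⟨fun x hx => ⟨(h1 x hx).1, ?_⟩, h2⟩
      have : x ≠ D + 1 := fun h => h3 (h ▸ hx)
      have := (h1 x hx).2
      omega
    · rintro ⟨h1, h2⟩
      refine ⟨⟨fun x hx => ⟨(h1 x hx).1, (h1 x hx).2.trans D.le_succ⟩, h2⟩, fun h => ?_⟩
      have := (h1 _ h).2
      omega
  · split_ifs with h
    · rw [← Finset.sum_neg_distrib]
      refine Finset.sum_nbij' (fun A => A.erase (D + 1)) (fun A => (D + 1) ::ₘ A) ?_ ?_ ?_ ?_ ?_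
      · intro A hA
        simp only [Finset.mem_filter, mem_boundedSet, not_not] at hA ⊢
        obtain ⟨B, rfl⟩ := exists_cons_of_mem hA.2
        simp only [erase_cons_head, sum_cons] at hA ⊢
        exact ⟨fun x hx => hA.1.1 x (mem_cons_of_mem hx), by omega⟩
      · intro A hA
        simp only [Finset.mem_filter, mem_boundedSet, not_not] at hA ⊢
        refine ⟨⟨?_, by simp; omega⟩, mem_cons_self _ _⟩
        intro x hx
        rcases mem_cons.1 hx with rfl | hx
        · omega
        · exact hA.1 x hx
      · intro A hA
        simp only [Finset.mem_filter, not_not] at hA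
        exact cons_erase hA.2
      · intro A _
        simp
      · intro A hA
        simp only [Finset.mem_filter, not_not] at hA
        obtain ⟨B, rfl⟩ := exists_cons_of_mem hA.2
        simp [pow_succ]
    · rw [neg_zero]
      refine Finset.sum_eq_zero fun A hA => ?_
      simp only [Finset.mem_filter, mem_boundedSet, not_not] at hA
      have := single_le_sum (fun x _ => Nat.zero_le x) _ hA.2
      omega

theorem card_distinctSet_succ (D N : ℕ) : (distinctSet (D + 1) N).card =
    if D + 1 ≤ N then (distinctSet (D + 1) (N - (D + 1))).card +
      (distinctSet D (N - (D + 1))).card else 0 := by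
  have key : ∀ A ∈ distinctSet (D + 1) N, (A.map (· - 1)).sum + (D + 1) = N := by
    intro A hA
    rw [mem_distinctSet] at hA
    have := sum_map_succ (A.map (· - 1))
    rw [map_succ_map_pred hA.2.2, card_map] at this
    omega
  have hnd : ∀ A : Multiset ℕ, 0 ∉ A → A.Nodup → (A.map (· - 1)).Nodup := by
    intro A h0 hA
    rw [← map_succ_map_pred h0] at hA
    exact hA.of_map _
  split_ifs with h
  · rw [← Finset.card_filter_add_card_filter_not (fun A => 1 ∉ A)]
    congr 1
    · refine Finset.card_nbij' (fun A => A.map (· - 1)) (fun A => A.map (· + 1)) ?_ ?_ ?_ ?_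
      · intro A hA
        simp only [Finset.coe_filter, Set.mem_ofPred_eq, Finset.mem_coe] at hA ⊢
        have hk := key A hA.1
        rw [mem_distinctSet] at hA ⊢
        refine ⟨⟨by simp [hA.1.1.1], by omega⟩, hnd A hA.1.2.2 hA.1.2.1, fun h0 => ?_⟩
        obtain ⟨x, hx, hx0⟩ := mem_map.1 h0
        have h1 : x ≠ 1 := fun e => hA.2 (e ▸ hx)
        have h2 : x ≠ 0 := fun e => hA.1.2.2 (e ▸ hx)
        omega
      · intro A hA
        simp only [Finset.coe_filter, Set.mem_ofPred_eq, mem_distinctSet, Finset.mem_coe] at hA ⊢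
        rw [sum_map_succ, card_map]
        refine ⟨⟨by omega, hA.2.1.map (add_left_injective 1), by simp⟩, by simpa using hA.2.2⟩
      · intro A hA
        simp only [Finset.coe_filter, Set.mem_ofPred_eq, mem_distinctSet] at hA
        exact map_succ_map_pred hA.1.2.2
      · intro A _
        simp
    · refine Finset.card_nbij' (fun A => (A.erase 1).map (· - 1))
        (fun A => 1 ::ₘ A.map (· + 1)) ?_ ?_ ?_ ?_
      · intro A hA
        simp only [Finset.coe_filter, Set.mem_ofPred_eq, Finset.mem_coe, not_not] at hA ⊢
        have hk := key A hA.1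
        rw [mem_distinctSet] at hA ⊢
        obtain ⟨B, rfl⟩ := exists_cons_of_mem hA.2
        simp only [erase_cons_head, map_cons, sum_cons, card_cons, nodup_cons, mem_cons,
          not_or] at hA hk ⊢
        refine ⟨⟨by simp; omega, by omega⟩, hnd B hA.1.2.2.2 hA.1.2.1.2, fun h0 => ?_⟩
        obtain ⟨x, hx, hx0⟩ := mem_map.1 h0
        have h1 : x ≠ 1 := fun e => hA.1.2.1.1 (e ▸ hx)
        have h2 : x ≠ 0 := fun e => hA.1.2.2.2 (e ▸ hx)
        omega
      · intro A hA
        simp only [Finset.coe_filter, Set.mem_ofPred_eq, mem_distinctSet, Finset.mem_coe] at hA ⊢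
        rw [card_cons, sum_cons, sum_map_succ, card_map, nodup_cons]
        refine ⟨⟨by omega, ⟨by simpa using hA.2.2, hA.2.1.map (add_left_injective 1)⟩, by simp⟩,
          by simp⟩
      · intro A hA
        simp only [Finset.coe_filter, Set.mem_ofPred_eq, mem_distinctSet, not_not] at hA
        simp only
        rw [map_succ_map_pred fun h => hA.1.2.2 (mem_of_mem_erase h), cons_erase hA.2]
      · intro A _
        simp
  · rw [Finset.card_eq_zero, Finset.eq_empty_iff_forall_notMem]
    intro A hA
    have := key A hA
    omega

theorem card_sumSet_zero (N : ℕ) : (sumSet 0 N).card = if N = 0 then 1 else 0 := by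
  split_ifs with h
  · subst h
    rw [Finset.card_eq_one]
    exact ⟨0, by ext A; simp +contextual [mem_sumSet]⟩
  · rw [Finset.card_eq_zero, Finset.eq_empty_iff_forall_notMem]
    intro A hA
    simp only [mem_sumSet, card_eq_zero] at hA
    simp [hA.1] at hA
    omega

theorem card_distinctSet_zero (N : ℕ) : (distinctSet 0 N).card = if N = 0 then 1 else 0 := by
  rw [← card_sumSet_zero]
  congr 1
  ext A
  simp +contextual [mem_sumSet, mem_distinctSet]

theorem sum_boundedSet_zero (N : ℕ) :
    ∑ B ∈ boundedSet 0 N, (-1 : ℤ) ^ card B = if N = 0 then 1 else 0 := by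
  have hmem : ∀ B, B ∈ boundedSet 0 N ↔ B = 0 ∧ N = 0 := by
    intro B
    rw [mem_boundedSet]
    constructor
    · rintro ⟨h1, h2⟩
      have : B = 0 := eq_zero_of_forall_notMem fun x hx => by have := h1 x hx; omega
      subst this
      simp at h2
      exact ⟨rfl, h2.symm⟩
    · rintro ⟨rfl, rfl⟩
      simp
  split_ifs with h
  · have : boundedSet 0 N = {0} := by ext B; rw [hmem]; simp [h]
    simp [this]
  · have : boundedSet 0 N = ∅ := by ext B; simp [hmem, h]
    simp [this]

/-- The generating function of `sumSet D`. -/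
noncomputable def sumSeries (D : ℕ) : ℤ⟦X⟧ := mk fun N => ((sumSet D N).card : ℤ)

/-- The generating function of `boundedSet D`, signed by the parity of the cardinality. -/
noncomputable def boundedSeries (D : ℕ) : ℤ⟦X⟧ :=
  mk fun N => ∑ B ∈ boundedSet D N, (-1 : ℤ) ^ card B

/-- The generating function of `distinctSet D` in the square of the variable. -/
noncomputable def distinctSeries (D : ℕ) : ℤ⟦X⟧ :=
  mk fun N => if Even N then ((distinctSet D (N / 2)).card : ℤ) else 0

theorem sumSeries_succ (D : ℕ) :
    sumSeries (D + 1) = sumSeries D + X ^ (D + 1) * sumSeries (D + 1) := by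
  ext N
  simp only [sumSeries, _root_.map_add, coeff_mk, coeff_X_pow_mul', card_sumSet_succ D N]
  push_cast
  rfl

theorem boundedSeries_succ (D : ℕ) :
    boundedSeries (D + 1) = boundedSeries D - X ^ (D + 1) * boundedSeries (D + 1) := by
  ext N
  simp only [boundedSeries, map_sub, coeff_mk, coeff_X_pow_mul', sum_boundedSet_succ D N]

theorem distinctSeries_succ (D : ℕ) : distinctSeries (D + 1) =
    X ^ (2 * (D + 1)) * (distinctSeries (D + 1) + distinctSeries D) := by
  ext N
  simp only [distinctSeries, _root_.map_add, coeff_mk, coeff_X_pow_mul', card_distinctSet_succ D (N / 2)]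
  by_cases h : 2 * (D + 1) ≤ N
  · have h1 : D + 1 ≤ N / 2 := by omega
    have h2 : (N - 2 * (D + 1)) / 2 = N / 2 - (D + 1) := by omega
    have h3 : Even (N - 2 * (D + 1)) ↔ Even N := by
      rw [Nat.even_sub h]; simp
    simp only [h, h1, if_true, h2, h3]
    split_ifs <;> simp
  · have h1 : ¬ D + 1 ≤ N / 2 := by omega
    simp [h, h1]

theorem series_identity (D : ℕ) :
    X ^ (D * D + D) * (sumSeries D * boundedSeries D) = distinctSeries D := by
  induction D with
  | zero =>
    have h1 : sumSeries 0 = 1 := by ext N; simp [sumSeries, card_sumSet_zero, coeff_one]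
    have h2 : boundedSeries 0 = 1 := by
      ext N; simp [boundedSeries, sum_boundedSet_zero, coeff_one]
    have h3 : distinctSeries 0 = 1 := by
      ext N
      simp only [distinctSeries, card_distinctSet_zero, coeff_one, coeff_mk]
      rcases N with _ | _ | N
      · simp
      · simp
      · have : (N + 1 + 1) / 2 ≠ 0 := by omega
        simp
    simp [h1, h2, h3]
  | succ D ih =>
    have hne : (1 - X ^ (2 * (D + 1)) : ℤ⟦X⟧) ≠ 0 := by
      intro h
      have := congrArg constantCoeff h
      simp at this
    refine mul_left_cancel₀ hne ?_
    have hE := distinctSeries_succ D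
    have hU := sumSeries_succ D
    have hC := boundedSeries_succ D
    have hU' : (1 - X ^ (D + 1)) * sumSeries (D + 1) = sumSeries D := by linear_combination hU
    have hC' : (1 + X ^ (D + 1)) * boundedSeries (D + 1) = boundedSeries D := by
      linear_combination hC
    have hE' : (1 - X ^ (2 * (D + 1))) * distinctSeries (D + 1) =
        X ^ (2 * (D + 1)) * distinctSeries D := by linear_combination hE
    rw [hE', ← ih, ← hU', ← hC']
    ring

/-- `D` is the side of the Durfee square of the partition with multiset of parts `S`. -/
def IsDurfee (D : ℕ) (S : Multiset ℕ) : Prop :=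
  card (S.filter (D < ·)) ≤ D ∧ D ≤ card (S.filter (D ≤ ·))

instance (D : ℕ) (S : Multiset ℕ) : Decidable (IsDurfee D S) :=
  inferInstanceAs (Decidable (_ ∧ _))

theorem exists_isDurfee (S : Multiset ℕ) : ∃ D, IsDurfee D S := by
  have hex : ∃ D, card (S.filter (D < ·)) ≤ D := ⟨card S, card_le_card (filter_le _ _)⟩
  classical
  refine ⟨Nat.find hex, Nat.find_spec hex, ?_⟩
  rcases h : Nat.find hex with _ | D
  · exact Nat.zero_le _
  · have := Nat.find_min hex (m := D) (by omega)
    simp only [not_le] at this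
    exact this

theorem IsDurfee.le {D D' : ℕ} {S : Multiset ℕ} (h : IsDurfee D S) (h' : IsDurfee D' S) :
    D' ≤ D := by
  by_contra! hlt
  have : card (S.filter (D' ≤ ·)) ≤ card (S.filter (D < ·)) :=
    card_le_card (monotone_filter_right S fun x hx => hlt.trans_le hx)
  have := h.1
  have := h'.2
  omega

theorem IsDurfee.le_card {D : ℕ} {S : Multiset ℕ} (h : IsDurfee D S) : D ≤ card S :=
  h.2.trans (card_le_card (filter_le _ _))

theorem IsDurfee.le_iff {D k : ℕ} {S : Multiset ℕ} (h : IsDurfee D S) :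
    card (S.filter (k < ·)) ≤ k ↔ D ≤ k := by
  constructor
  · intro hk
    by_contra! hlt
    have : card (S.filter (D ≤ ·)) ≤ card (S.filter (k < ·)) :=
      card_le_card (monotone_filter_right S fun x hx => hlt.trans_le hx)
    have := h.2
    omega
  · intro hk
    have : card (S.filter (k < ·)) ≤ card (S.filter (D < ·)) :=
      card_le_card (monotone_filter_right S fun x hx => hk.trans_lt hx)
    have := h.1
    omega

theorem crank_nonpos_iff {n D : ℕ} (hn : n ≠ 0) (P : Nat.Partition n)
    (h : IsDurfee D P.parts) : crank P ≤ 0 ↔ D ≤ P.parts.count 1 := by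
  have hne : P.parts ≠ 0 := by
    intro h0
    have := P.parts_sum
    simp [h0] at this
    omega
  obtain ⟨a, ha⟩ := exists_mem_of_ne_zero hne
  rw [crank]
  split_ifs with h0
  · rw [partOmega] at h0
    have h1 := P.parts_pos ha
    have h2 : a ≤ P.parts.sup := le_sup ha
    rw [h0]
    have h3 : D ≠ 0 := by
      rintro rfl
      have h4 := h.1
      simp only [nonpos_iff_eq_zero, card_eq_zero, filter_eq_nil] at h4
      exact h4 a ha h1
    omega
  · rw [← h.le_iff, partMu, partOmega]
    omega

theorem filter_lt_map_add {D : ℕ} {A B : Multiset ℕ} (hB : ∀ x ∈ B, x ≤ D) :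
    (A.map (· + D) + B).filter (D < ·) = (A.filter (0 < ·)).map (· + D) := by
  rw [filter_add, filter_map, filter_eq_nil.2 fun x hx => not_lt.2 (hB x hx), add_zero]
  congr 1
  exact filter_congr fun x _ => by simp

theorem filter_pos_add_replicate (A : Multiset ℕ) :
    A.filter (0 < ·) + replicate (card A - card (A.filter (0 < ·))) 0 = A := by
  conv_rhs => rw [← filter_add_not (0 < ·) A]
  congr 1
  symm
  rw [eq_replicate]
  constructor
  · have := congrArg card (filter_add_not (0 < ·) A)
    rw [card_add] at this
    omega
  · intro b hb
    simpa using (mem_filter.1 hb).2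

theorem isDurfee_add {D : ℕ} {A B : Multiset ℕ} (hA : card A = D) (hB : ∀ x ∈ B, x ≤ D) :
    IsDurfee D (A.map (· + D) + B) := by
  constructor
  · rw [filter_lt_map_add hB, card_map, ← hA]
    exact card_le_card (filter_le _ _)
  · rw [filter_add, filter_eq_self.2, card_add, card_map, hA]
    · omega
    · intro x hx
      obtain ⟨y, -, rfl⟩ := mem_map.1 hx
      simp

theorem map_add_add_injective {D : ℕ} {A B A' B' : Multiset ℕ} (hA : card A = D) (hA' : card A' = D)
    (hB : ∀ x ∈ B, x ≤ D) (hB' : ∀ x ∈ B', x ≤ D)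
    (h : A.map (· + D) + B = A'.map (· + D) + B') : A = A' ∧ B = B' := by
  have h1 := congrArg (filter (D < ·)) h
  rw [filter_lt_map_add hB, filter_lt_map_add hB'] at h1
  have h2 := map_injective (add_left_injective D) h1
  have h3 : A = A' := by
    rw [← filter_pos_add_replicate A, ← filter_pos_add_replicate A', h2, hA, hA']
  subst h3
  exact ⟨rfl, add_left_cancel h⟩

theorem IsDurfee.exists_eq {D : ℕ} {S : Multiset ℕ} (h : IsDurfee D S) :
    ∃ A B : Multiset ℕ, card A = D ∧ (∀ x ∈ B, x ≤ D) ∧ A.map (· + D) + B = S := by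
  have h1 := h.1
  set m := card (S.filter (D < ·)) with hm
  have hsplit : S.filter (D ≤ ·) = S.filter (D < ·) + replicate (S.count D) D := by
    ext a
    simp only [count_filter, count_add, count_replicate]
    rcases lt_trichotomy a D with ha | rfl | ha
    · simp [ha.not_ge, ha.ne', ha.not_gt]
    · simp
    · simp [ha.le, ha.ne, ha]
  have h2 : D ≤ m + S.count D := by
    have := h.2
    rwa [hsplit, card_add, card_replicate] at this
  have hle : replicate (D - m) D ≤ S.filter (¬ D < ·) := by
    rw [← le_count_iff_replicate_le, count_filter]
    simp
    omega
  refine ⟨(S.filter (D < ·)).map (· - D) + replicate (D - m) 0,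
    S.filter (¬ D < ·) - replicate (D - m) D, ?_, ?_, ?_⟩
  · rw [card_add, card_map, card_replicate]
    omega
  · intro x hx
    simpa using (mem_filter.1 (mem_of_le tsub_le_self hx)).2
  · rw [Multiset.map_add, map_replicate, zero_add, add_assoc, add_tsub_cancel_of_le hle, map_map]
    conv_rhs => rw [← filter_add_not (D < ·) S]
    congr 1
    conv_rhs => rw [← map_id (S.filter (D < ·))]
    refine map_congr rfl fun x hx => ?_
    have := (mem_filter.1 hx).2
    simp
    omega

theorem le_count_one_iff {D : ℕ} {A B : Multiset ℕ} (hA : card A = D)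
    (hB : ∀ x ∈ B, 1 ≤ x ∧ x ≤ D) (hn : 2 ≤ (A.map (· + D) + B).sum) :
    D ≤ (A.map (· + D) + B).count 1 ↔ D ≤ B.count 1 := by
  rw [count_add]
  rcases lt_trichotomy D 1 with h | rfl | h
  · omega
  · obtain ⟨a, rfl⟩ := card_eq_one.1 hA
    refine ⟨fun h1 => ?_, fun h1 => by omega⟩
    by_contra! h2
    have hB0 : B = 0 := eq_zero_of_forall_notMem fun x hx => by
      have h3 : x = 1 := by have := hB x hx; omega
      have := one_le_count_iff_mem.2 (h3 ▸ hx)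
      omega
    subst hB0
    simp at hn h1
    rw [count_singleton] at h1
    split_ifs at h1 <;> omega
  · rw [count_eq_zero_of_notMem, zero_add]
    intro h1
    obtain ⟨y, -, hy⟩ := mem_map.1 h1
    omega

theorem sum_isDurfee (n D : ℕ) (hn : 2 ≤ n) :
    ∑ P : Nat.Partition n with crank P ≤ 0 ∧ IsDurfee D P.parts, (-1 : ℤ) ^ card P.parts =
      coeff n (X ^ (D * D + D) * (sumSeries D * boundedSeries D)) := by
  have hinv : ∀ P : Nat.Partition n, crank P ≤ 0 → IsDurfee D P.parts →
      ∃ A B : Multiset ℕ, card A = D ∧ (∀ x ∈ B, 1 ≤ x ∧ x ≤ D) ∧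
        A.sum + B.sum + (D * D + D) = n ∧ A.map (· + D) + (B + replicate D 1) = P.parts := by
    intro P hP hD
    obtain ⟨A, B, hA, hB, hS⟩ := hD.exists_eq
    have hB1 : ∀ x ∈ B, 1 ≤ x ∧ x ≤ D := fun x hx =>
      ⟨P.parts_pos (hS ▸ mem_add.2 (Or.inr hx)), hB x hx⟩
    rw [crank_nonpos_iff (by omega) P hD, ← hS,
      le_count_one_iff hA hB1 (by rw [hS, P.parts_sum]; exact hn), le_count_iff_replicate_le] at hP
    have hBeq : B - replicate D 1 + replicate D 1 = B := tsub_add_cancel_of_le hP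
    refine ⟨A, B - replicate D 1, hA, fun x hx => hB1 x (mem_of_le tsub_le_self hx), ?_, ?_⟩
    · have h1 := P.parts_sum
      have h2 := congrArg Multiset.sum hBeq
      rw [← hS] at h1
      simp [sum_map_add, hA] at h1 h2
      omega
    · rw [hBeq, hS]
  rw [coeff_X_pow_mul']
  split_ifs with hle
  · rw [coeff_mul]
    simp only [sumSeries, boundedSeries, coeff_mk, Finset.card_eq_sum_ones, Nat.cast_sum,
      Finset.sum_mul_sum, Nat.cast_one, one_mul]
    simp only [← Finset.sum_product']
    rw [Finset.sum_sigma']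
    symm
    have hmem : ∀ x : (_ : ℕ × ℕ) × (Multiset ℕ × Multiset ℕ),
        x ∈ (Finset.HasAntidiagonal.antidiagonal (n - (D * D + D))).sigma
          (fun p => sumSet D p.1 ×ˢ boundedSet D p.2) →
        card x.2.1 = D ∧ (∀ y ∈ x.2.2, 1 ≤ y ∧ y ≤ D) ∧ x.2.1.sum = x.1.1 ∧ x.2.2.sum = x.1.2 ∧
          x.2.1.sum + x.2.2.sum + (D * D + D) = n := by
      intro x hx
      simp only [Finset.mem_sigma, Finset.HasAntidiagonal.mem_antidiagonal, Finset.mem_product, mem_sumSet,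
        mem_boundedSet] at hx
      obtain ⟨h1, ⟨h2, h3⟩, h4, h5⟩ := hx
      exact ⟨h2, h4, h3, h5, by omega⟩
    have hbd : ∀ B : Multiset ℕ, (∀ y ∈ B, 1 ≤ y ∧ y ≤ D) →
        ∀ y ∈ B + replicate D 1, 1 ≤ y ∧ y ≤ D := by
      intro B hB y hy
      rcases mem_add.1 hy with hy | hy
      · exact hB y hy
      · have h1 := eq_of_mem_replicate hy
        have h2 : D ≠ 0 := by rintro rfl; simp at hy
        omega
    refine Finset.sum_bij (fun x hx =>
      { parts := x.2.1.map (· + D) + (x.2.2 + replicate D 1)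
        parts_pos := ?_
        parts_sum := ?_ }) ?_ ?_ ?_ ?_
    · intro y hy
      obtain ⟨h1, h2, h3, h4, h5⟩ := hmem x hx
      rcases mem_add.1 hy with hy | hy
      · obtain ⟨z, hz, rfl⟩ := mem_map.1 hy
        have := card_pos_iff_exists_mem.2 ⟨z, hz⟩
        omega
      · exact (hbd _ h2 y hy).1
    · obtain ⟨h1, h2, h3, h4, h5⟩ := hmem x hx
      simp [sum_map_add, h1]
      omega
    · intro x hx
      obtain ⟨h1, h2, h3, h4, h5⟩ := hmem x hx
      have hD := isDurfee_add h1 fun y hy => (hbd _ h2 y hy).2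
      rw [Finset.mem_filter]
      refine ⟨Finset.mem_univ _, ?_, hD⟩
      rw [crank_nonpos_iff (by omega) _ hD]
      simp
      omega
    · intro x hx y hy hxy
      obtain ⟨h1, h2, h3, h4, h5⟩ := hmem x hx
      obtain ⟨h1', h2', h3', h4', h5'⟩ := hmem y hy
      obtain ⟨e1, e2⟩ := map_add_add_injective h1 h1' (fun y hy => (hbd _ h2 y hy).2)
        (fun y hy => (hbd _ h2' y hy).2) (congrArg Nat.Partition.parts hxy)
      have e3 := add_right_cancel e2
      obtain ⟨⟨i, j⟩, A, B⟩ := x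
      obtain ⟨⟨i', j'⟩, A', B'⟩ := y
      simp only at *
      subst e1 e3 h3 h4 h3' h4'
      rfl
    · intro P hP
      rw [Finset.mem_filter] at hP
      obtain ⟨A, B, hA, hB, hs, hS⟩ := hinv P hP.2.1 hP.2.2
      refine ⟨⟨(A.sum, B.sum), A, B⟩, ?_, Nat.Partition.ext hS⟩
      simp only [Finset.mem_sigma, Finset.HasAntidiagonal.mem_antidiagonal, Finset.mem_product, mem_sumSet,
        mem_boundedSet]
      exact ⟨by omega, ⟨hA, trivial⟩, hB, trivial⟩
    · intro x hx
      obtain ⟨h1, -⟩ := hmem x hx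
      simp only [card_add, card_map, card_replicate, h1, pow_add]
      rw [mul_left_comm, ← mul_pow]
      simp
  · refine Finset.sum_eq_zero fun P hP => ?_
    rw [Finset.mem_filter] at hP
    obtain ⟨A, B, hA, hB, hs, hS⟩ := hinv P hP.2.1 hP.2.2
    omega

theorem q_eq_sum (m N : ℕ) (h : m ≤ N) :
    q m = ∑ D ∈ Finset.range (N + 1), (distinctSet D m).card := by
  classical
  rw [q, Nat.card_eq_fintype_card, Fintype.card_subtype,
    Finset.card_eq_sum_card_fiberwise (f := fun P => card P.parts) (t := Finset.range (N + 1))]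
  · refine Finset.sum_congr rfl fun D _ => ?_
    refine Finset.card_bij (fun P _ => P.parts) ?_ (fun P _ Q _ h => Nat.Partition.ext h) ?_
    · intro P hP
      simp only [Finset.mem_filter, Finset.mem_univ, true_and] at hP
      exact mem_distinctSet.2 ⟨⟨hP.2, P.parts_sum⟩, hP.1, fun h0 => (P.parts_pos h0).ne rfl⟩
    · intro A hA
      rw [mem_distinctSet] at hA
      refine ⟨⟨A, fun {i} hi => Nat.pos_of_ne_zero fun h0 => hA.2.2 (h0 ▸ hi), hA.1.2⟩, ?_, rfl⟩
      simp [hA.1.1, hA.2.1]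
  · intro P _
    have : card P.parts ≤ P.parts.sum := card_le_sum fun x hx => P.parts_pos hx
    rw [P.parts_sum] at this
    simp
    omega

theorem sum_crank_nonpos (n : ℕ) (hn : 2 ≤ n) :
    ∑ P : Nat.Partition n with crank P ≤ 0, (-1 : ℤ) ^ card P.parts =
      if Even n then (q (n / 2) : ℤ) else 0 := by
  have hstep : ∀ P : Nat.Partition n, (-1 : ℤ) ^ card P.parts =
      ∑ D ∈ Finset.range (n + 1), if IsDurfee D P.parts then (-1 : ℤ) ^ card P.parts else 0 := by
    intro P
    obtain ⟨D, hD⟩ := exists_isDurfee P.parts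
    have hc : card P.parts ≤ P.parts.sum := card_le_sum fun x hx => P.parts_pos hx
    rw [P.parts_sum] at hc
    have := hD.le_card
    rw [Finset.sum_eq_single D, if_pos hD]
    · intro D' _ hne
      exact if_neg fun h => hne (le_antisymm (hD.le h) (h.le hD))
    · intro h
      simp at h
      omega
  rw [Finset.sum_congr rfl fun P _ => hstep P, Finset.sum_comm,
    q_eq_sum (n / 2) n (Nat.div_le_self n 2)]
  have : ∀ D, (∑ P : Nat.Partition n with crank P ≤ 0,
      if IsDurfee D P.parts then (-1 : ℤ) ^ card P.parts else 0) =
      if Even n then ((distinctSet D (n / 2)).card : ℤ) else 0 := by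
    intro D
    rw [← Finset.sum_filter, Finset.filter_filter, sum_isDurfee n D hn, series_identity,
      distinctSeries, coeff_mk]
  simp only [this]
  split_ifs <;> simp

theorem card_even_sub_card_odd (n : ℕ) :
    (Nat.card {P : Nat.Partition n // crank P ≤ 0 ∧ Even (card P.parts)} : ℤ) -
      Nat.card {P : Nat.Partition n // crank P ≤ 0 ∧ Odd (card P.parts)} =
    ∑ P : Nat.Partition n with crank P ≤ 0, (-1 : ℤ) ^ card P.parts := by
  rw [Nat.card_eq_fintype_card, Nat.card_eq_fintype_card, Fintype.card_subtype,
    Fintype.card_subtype, ← Finset.sum_filter_add_sum_filter_not _ (fun P => Even (card P.parts)),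
    Finset.filter_filter, Finset.filter_filter, sub_eq_add_neg]
  congr 1
  · rw [Finset.sum_congr rfl fun P hP => (Finset.mem_filter.1 hP).2.2.neg_one_pow]
    simp
  · simp only [Nat.not_even_iff_odd]
    rw [Finset.sum_congr rfl fun P hP => (Finset.mem_filter.1 hP).2.2.neg_one_pow]
    simp

end CrankParity

/-- For `n ≥ 2`: if `n` is odd then `M^e_{≤0}(n) = M^o_{≤0}(n)`, and if `n` is even then
`M^e_{≤0}(n) = M^o_{≤0}(n) + q(n/2)`. -/
theorem stmt_17 (n : ℕ) (hn : 2 ≤ n) :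
    (Odd n →
      Nat.card {P : Nat.Partition n // crank P ≤ 0 ∧ Even (Multiset.card P.parts)} =
        Nat.card {P : Nat.Partition n // crank P ≤ 0 ∧ Odd (Multiset.card P.parts)}) ∧
    (Even n →
      Nat.card {P : Nat.Partition n // crank P ≤ 0 ∧ Even (Multiset.card P.parts)} =
        Nat.card {P : Nat.Partition n // crank P ≤ 0 ∧ Odd (Multiset.card P.parts)} +
          q (n / 2)) := by
  have h := CrankParity.card_even_sub_card_odd n
  rw [CrankParity.sum_crank_nonpos n hn] at h
  constructor
  · intro ho
    rw [if_neg (Nat.not_even_iff_odd.2 ho)] at h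
    omega
  · intro he
    rw [if_pos he] at h
    omega
end
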